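/- Let d ≥ 1, let α, β ∈ ℤ^d with α ▹ 0 and β ▹ 0, and suppose (2q+1)·α = (2p+1)·β for nonnegative integers p, q with gcd(2p+1, 2q+1) = 1. Then 3·⟨𝒮(α·x), 𝒮(β·x)⟩ = (−1)^{p+q}/((2p+1)²·(2q+1)²) in L²([0,1]^d). -/

import Mathlib

open MeasureTheory Filter Topology

/-- The 1-periodic piecewise linear "cosine-like" function:
`𝒞(x) = 4|x - 1/2| - 1` on `[0,1]`, extended by `𝒞(x) = 𝒞(x - ⌊x⌋)`. -/
noncomputable def Cfun (x : ℝ) : ℝ := 4 * |Int.fract x - 1 / 2| - 1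

/-- The 1-periodic piecewise linear "sine-like" function:
`𝒮(x) = |2 - 4|x - 1/4|| - 1` on `[0,1]`, extended by `𝒮(x) = 𝒮(x - ⌊x⌋)`. -/
noncomputable def Sfun (x : ℝ) : ℝ := abs (2 - 4 * |Int.fract x - 1 / 4|) - 1

/-- `α ▹ 0`: the first nonzero entry of the integer vector `α` is positive. -/
def PosLead {d : ℕ} (α : Fin d → ℤ) : Prop :=
  ∃ i : Fin d, 0 < α i ∧ ∀ j : Fin d, j < i → α j = 0

/-- The second Bernoulli polynomial, extended `1`-periodically from `[0, 1)`. -/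
noncomputable def bernoulliTwoFract (x : ℝ) : ℝ := Int.fract x ^ 2 - Int.fract x + 1 / 6

theorem bernoulliTwoFract_add_int (x : ℝ) (m : ℤ) :
    bernoulliTwoFract (x + m) = bernoulliTwoFract x := by
  simp [bernoulliTwoFract]

theorem bernoulliTwoFract_of_mem_Ico {x : ℝ} (hx : x ∈ Set.Ico (0 : ℝ) 1) :
    bernoulliTwoFract x = x ^ 2 - x + 1 / 6 := by
  rw [bernoulliTwoFract, Int.fract_eq_self.2 ⟨hx.1, hx.2⟩]

theorem sum_quadratic_add_div (a : ℕ) (n : ℝ) (hn : n ≠ 0) (t : ℝ) :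
    ∑ j ∈ Finset.range a, ((t + j / n) ^ 2 - (t + j / n) + 1 / 6) =
      a * t ^ 2 + t * a * (a - 1) / n + a * (a - 1) * (2 * a - 1) / (6 * n ^ 2)
        - a * t - a * (a - 1) / (2 * n) + a / 6 := by
  induction a with
  | zero => simp
  | succ k ih =>
    rw [Finset.sum_range_succ, ih]
    push_cast
    field_simp
    ring

/-- The multiplication theorem for the periodized second Bernoulli polynomial. -/
theorem sum_bernoulliTwoFract_add_div {a : ℕ} (ha : a ≠ 0) (t : ℝ) :
    ∑ j ∈ Finset.range a, bernoulliTwoFract (t + j / a) = bernoulliTwoFract (a * t) / a := by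
  have ha' : (0 : ℝ) < a := by positivity
  have hper : Function.Periodic (fun t : ℝ => ∑ j ∈ Finset.range a, bernoulliTwoFract (t + j / a)
      - bernoulliTwoFract (a * t) / a) (1 / a : ℝ) := by
    intro t
    have h1 : bernoulliTwoFract (a * (t + 1 / a)) = bernoulliTwoFract (a * t) := by
      rw [← bernoulliTwoFract_add_int (a * t) 1]
      congr 1
      push_cast
      field_simp
    have h2 : ∑ j ∈ Finset.range a, bernoulliTwoFract (t + 1 / a + j / a) =
        ∑ j ∈ Finset.range a, bernoulliTwoFract (t + j / a) := by
      have h3 := Finset.sum_range_succ (fun j : ℕ => bernoulliTwoFract (t + j / a)) a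
      rw [Finset.sum_range_succ', div_self ha'.ne'] at h3
      have h4 := bernoulliTwoFract_add_int t 1
      simp only [Nat.cast_add, Nat.cast_one, Nat.cast_zero, zero_div, add_zero,
        Int.cast_one] at h3 h4
      rw [h4] at h3
      rw [← add_right_cancel h3]
      refine Finset.sum_congr rfl fun j _ => ?_
      congr 1
      ring
    simp only [h1, h2]
  obtain ⟨y, ⟨hy0, hy1⟩, hy⟩ := hper.exists_mem_Ico₀ (by positivity) t
  refine sub_eq_zero.1 (hy.trans (sub_eq_zero.2 ?_))
  have hay : a * y < 1 := by
    rw [lt_div_iff₀ ha'] at hy1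
    linarith
  rw [bernoulliTwoFract_of_mem_Ico ⟨by positivity, hay⟩]
  have hsum : ∀ j ∈ Finset.range a, bernoulliTwoFract (y + j / a) =
      (y + j / a) ^ 2 - (y + j / a) + 1 / 6 := by
    intro j hj
    refine bernoulliTwoFract_of_mem_Ico ⟨by positivity, ?_⟩
    have hj' : (j : ℝ) + 1 ≤ a := by exact_mod_cast Finset.mem_range.1 hj
    have : y + j / a = (a * y + j) / a := by field_simp
    rw [this, div_lt_one ha']
    linarith
  rw [Finset.sum_congr rfl hsum, sum_quadratic_add_div a a ha'.ne' y]
  field_simp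
  ring

theorem Sfun_periodic : Function.Periodic Sfun 1 := by
  intro x
  simp [Sfun]

theorem Sfun_add_int (x : ℝ) (m : ℤ) : Sfun (x + m) = Sfun x := by
  simp [Sfun]

theorem continuous_Sfun : Continuous Sfun := by
  have h : ContinuousOn (fun z : ℝ => abs (2 - 4 * |z - 1 / 4|) - 1) (Set.Icc 0 1) := by fun_prop
  exact h.comp_fract'' (by norm_num [abs_of_pos, abs_of_neg])

theorem Sfun_eq_bernoulliTwoFract (x : ℝ) :
    Sfun x = 4 * (bernoulliTwoFract (x - 1 / 4) - bernoulliTwoFract (x + 1 / 4)) := by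
  have hx : x = Int.fract x + (⌊x⌋ : ℤ) := (Int.fract_add_floor x).symm
  rw [hx, Sfun_add_int, add_sub_right_comm, add_right_comm, bernoulliTwoFract_add_int,
    bernoulliTwoFract_add_int, Sfun, Int.fract_fract]
  have h0 := Int.fract_nonneg x
  have h1 := Int.fract_lt_one x
  generalize Int.fract x = z at h0 h1
  rcases lt_or_ge z (1 / 4) with hz | hz
  · rw [← bernoulliTwoFract_add_int (z - 1 / 4) 1,
      bernoulliTwoFract_of_mem_Ico ⟨by push_cast; linarith, by push_cast; linarith⟩,
      bernoulliTwoFract_of_mem_Ico ⟨by linarith, by linarith⟩,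
      abs_of_neg (by linarith : z - 1 / 4 < 0), abs_of_pos (by linarith)]
    push_cast
    ring
  rw [abs_of_nonneg (by linarith : 0 ≤ z - 1 / 4),
    bernoulliTwoFract_of_mem_Ico (x := z - 1 / 4) ⟨by linarith, by linarith⟩]
  rcases lt_or_ge z (3 / 4) with hz' | hz'
  · rw [bernoulliTwoFract_of_mem_Ico ⟨by linarith, by linarith⟩, abs_of_pos (by linarith)]
    ring
  · rw [← bernoulliTwoFract_add_int (z + 1 / 4) (-1),
      bernoulliTwoFract_of_mem_Ico ⟨by push_cast; linarith, by push_cast; linarith⟩,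
      abs_of_nonpos (by linarith)]
    push_cast
    ring

theorem bernoulliTwoFract_sub_odd_quarter (p : ℕ) (y : ℝ) :
    4 * (bernoulliTwoFract (y - (2 * p + 1) / 4) - bernoulliTwoFract (y + (2 * p + 1) / 4)) =
      (-1) ^ p * Sfun y := by
  induction p with
  | zero => simp [Sfun_eq_bernoulliTwoFract]
  | succ p ih =>
    have h1 : y - (2 * ((p + 1 : ℕ) : ℝ) + 1) / 4 =
        y + (2 * p + 1) / 4 + ((-(p + 1) : ℤ) : ℝ) := by
      push_cast
      ring
    have h2 : y + (2 * ((p + 1 : ℕ) : ℝ) + 1) / 4 =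
        y - (2 * p + 1) / 4 + ((p + 1 : ℤ) : ℝ) := by
      push_cast
      ring
    rw [h1, h2, bernoulliTwoFract_add_int, bernoulliTwoFract_add_int, pow_succ]
    linarith

theorem sum_Sfun_add_div (p : ℕ) (t : ℝ) :
    ∑ j ∈ Finset.range (2 * p + 1), Sfun (t + j / (2 * p + 1)) =
      (-1) ^ p / (2 * p + 1) * Sfun ((2 * p + 1) * t) := by
  have h1 := sum_bernoulliTwoFract_add_div (Nat.succ_ne_zero (2 * p)) (t - 1 / 4)
  have h2 := sum_bernoulliTwoFract_add_div (Nat.succ_ne_zero (2 * p)) (t + 1 / 4)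
  have h3 := bernoulliTwoFract_sub_odd_quarter p ((2 * p + 1) * t)
  have h4 : (2 * (p : ℝ) + 1) * t - (2 * p + 1) / 4 = (2 * p + 1) * (t - 1 / 4) := by ring
  have h5 : (2 * (p : ℝ) + 1) * t + (2 * p + 1) / 4 = (2 * p + 1) * (t + 1 / 4) := by ring
  rw [h4, h5] at h3
  push_cast [Nat.succ_eq_add_one] at h1 h2
  simp_rw [Sfun_eq_bernoulliTwoFract (t + _), ← Finset.mul_sum, Finset.sum_sub_distrib,
    add_sub_right_comm t _ (1 / 4 : ℝ), add_right_comm t _ (1 / 4 : ℝ)]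
  rw [h1, h2, ← sub_div, ← mul_div_assoc, h3]
  ring

theorem Function.Periodic.intervalIntegral_comp_int_mul_add {f : ℝ → ℝ}
    (hf : Function.Periodic f 1) (hc : Continuous f) {m : ℤ} (hm : m ≠ 0) (c : ℝ) :
    ∫ t in (0 : ℝ)..1, f (m * t + c) = ∫ t in (0 : ℝ)..1, f t := by
  have hm' : (m : ℝ) ≠ 0 := by exact_mod_cast hm
  have h := hf.intervalIntegral_add_zsmul_eq m c fun _ _ => hc.intervalIntegrable _ _
  rw [intervalIntegral.integral_comp_mul_add f hm']
  simp only [zsmul_eq_mul, mul_one] at h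
  rw [mul_zero, zero_add, mul_one, add_comm (m : ℝ) c, h, hf.intervalIntegral_add_eq c 0,
    zero_add, smul_eq_mul, inv_mul_cancel_left₀ hm']

theorem integral_Sfun_mul_Sfun_of_isCoprime (p : ℕ) {b : ℤ} (hb : IsCoprime (2 * p + 1 : ℤ) b) :
    ∫ t in (0 : ℝ)..1, Sfun ((2 * p + 1) * t) * Sfun (b * t) =
      (-1) ^ p / (2 * p + 1) ^ 2 * ∫ t in (0 : ℝ)..1, Sfun t * Sfun (b * t) := by
  obtain ⟨u, v, huv⟩ := hb
  have hS := continuous_Sfun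
  have ha : (2 * p + 1 : ℝ) ≠ 0 := by positivity
  have huv' : (u : ℝ) * (2 * p + 1) + v * b = 1 := by exact_mod_cast huv
  have hper : Function.Periodic (fun t : ℝ => Sfun ((2 * p + 1) * t) * Sfun (b * t)) 1 := by
    intro t
    have h1 := Sfun_add_int ((2 * p + 1) * t) (2 * p + 1)
    have h2 := Sfun_add_int (b * t) b
    push_cast at h1
    simp only [mul_add, mul_one] at h1 h2 ⊢
    rw [h2, ← h1]
  have hshift : ∀ j : ℕ, ∫ t in (0 : ℝ)..1, Sfun ((2 * p + 1) * t) * Sfun (b * t) =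
      ∫ t in (0 : ℝ)..1, Sfun ((2 * p + 1) * t) * Sfun (b * t + j / (2 * p + 1)) := by
    intro j
    rw [← hper.intervalIntegral_comp_int_mul_add (by fun_prop) one_ne_zero (j * v / (2 * p + 1))]
    refine intervalIntegral.integral_congr fun t _ => ?_
    have h1 : (2 * (p : ℝ) + 1) * ((1 : ℤ) * t + j * v / (2 * p + 1)) =
        (2 * p + 1) * t + ((j * v : ℤ) : ℝ) := by
      push_cast
      field_simp
    have h2 : (b : ℝ) * ((1 : ℤ) * t + j * v / (2 * p + 1)) =
        b * t + j / (2 * p + 1) + ((-(j * u) : ℤ) : ℝ) := by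
      push_cast
      field_simp
      linear_combination (j : ℝ) * huv'
    simp only [h1, h2, Sfun_add_int]
  have hprod : Function.Periodic (fun t : ℝ => Sfun t * Sfun (b * t)) 1 := by
    intro t
    simp only [mul_add, mul_one, Sfun_add_int, Sfun_periodic t]
  have hscale := hprod.intervalIntegral_comp_int_mul_add (by fun_prop) (m := 2 * p + 1) (by positivity) 0
  have hsum : (2 * p + 1 : ℝ) * ∫ t in (0 : ℝ)..1, Sfun ((2 * p + 1) * t) * Sfun (b * t) =
      ∫ t in (0 : ℝ)..1, (-1) ^ p / (2 * p + 1) *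
        (Sfun ((2 * p + 1) * t) * Sfun (b * ((2 * p + 1) * t))) := by
    calc _ = ∑ j ∈ Finset.range (2 * p + 1), ∫ t in (0 : ℝ)..1,
          Sfun ((2 * p + 1) * t) * Sfun (b * t + j / (2 * p + 1)) := by
          rw [← Finset.sum_congr rfl fun j _ => hshift j]
          simp
      _ = _ := by
          rw [← intervalIntegral.integral_finsetSum]
          · refine intervalIntegral.integral_congr fun t _ => ?_
            simp only [← Finset.mul_sum, sum_Sfun_add_div]
            rw [mul_left_comm (b : ℝ)]
            ring
          · exact fun j _ => Continuous.intervalIntegrable (by fun_prop) _ _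
  push_cast at hscale
  simp only [add_zero] at hscale
  rw [intervalIntegral.integral_const_mul, hscale] at hsum
  field_simp
  field_simp at hsum
  linarith

theorem integral_Sfun_mul_self : ∫ t in (0 : ℝ)..1, Sfun t * Sfun t = 1 / 3 := by
  have hS : ∀ a b : ℝ, IntervalIntegrable (fun t => Sfun t * Sfun t) volume a b := fun a b =>
    (continuous_Sfun.mul continuous_Sfun).intervalIntegrable a b
  have hpiece : ∀ a b c : ℝ, a ≤ b →
      (∀ t, a ≤ t → t < b → Sfun t * Sfun t = 16 * (t - c) ^ 2) →
      ∫ t in a..b, Sfun t * Sfun t = 16 * ((b - c) ^ 3 - (a - c) ^ 3) / 3 := by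
    intro a b c hab h
    rw [intervalIntegral.integral_of_le hab, ← integral_Ico_eq_integral_Ioc,
      setIntegral_congr_fun measurableSet_Ico fun t ht => h t ht.1 ht.2,
      integral_Ico_eq_integral_Ioc, ← intervalIntegral.integral_of_le hab,
      intervalIntegral.integral_const_mul,
      intervalIntegral.integral_comp_sub_right (fun t => t ^ 2) c, integral_pow]
    norm_num
    ring
  rw [← intervalIntegral.integral_add_adjacent_intervals (hS 0 (1 / 4)) (hS _ 1),
    ← intervalIntegral.integral_add_adjacent_intervals (hS (1 / 4) (3 / 4)) (hS _ 1),
    hpiece 0 (1 / 4) 0, hpiece (1 / 4) (3 / 4) (1 / 2), hpiece (3 / 4) 1 1]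
  any_goals norm_num
  · intro t h1 h2
    rw [Sfun, Int.fract_eq_self.2 ⟨by linarith, h2⟩, abs_of_pos (by linarith : 0 < t - 1 / 4),
      abs_of_nonpos (by linarith)]
    ring
  · intro t h1 h2
    rw [Sfun, Int.fract_eq_self.2 ⟨by linarith, by linarith⟩,
      abs_of_nonneg (by linarith : 0 ≤ t - 1 / 4), abs_of_nonneg (by linarith)]
    ring
  · intro t h1 h2
    rw [Sfun, Int.fract_eq_self.2 ⟨by linarith, by linarith⟩,
      abs_of_neg (by linarith : t - 1 / 4 < 0), abs_of_nonneg (by linarith)]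
    ring

theorem integral_Sfun_odd_mul_Sfun_odd (p q : ℕ) (hpq : Nat.gcd (2 * p + 1) (2 * q + 1) = 1) :
    ∫ t in (0 : ℝ)..1, Sfun ((2 * p + 1) * t) * Sfun ((2 * q + 1) * t) =
      (-1) ^ (p + q) / ((2 * p + 1) ^ 2 * (2 * q + 1) ^ 2) / 3 := by
  have hc : IsCoprime (2 * p + 1 : ℤ) (2 * q + 1) := by
    exact_mod_cast Nat.isCoprime_iff_coprime.2 hpq
  have h1 := integral_Sfun_mul_Sfun_of_isCoprime p hc
  have h2 := integral_Sfun_mul_Sfun_of_isCoprime q (isCoprime_one_right (x := (2 * q + 1 : ℤ)))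
  push_cast at h1 h2
  simp only [one_mul, integral_Sfun_mul_self] at h2
  simp only [mul_comm (Sfun _) (Sfun ((2 * (q : ℝ) + 1) * _))] at h1
  rw [h2] at h1
  simp only [mul_comm (Sfun ((2 * (p : ℝ) + 1) * _)), h1]
  field_simp
  ring

/-- If `f` is continuous and `1`-periodic and `γ ≠ 0` is an integer vector, then `f (γ ⬝ x)` has
the same mean over the unit cube as `f` over the unit interval. -/
theorem Function.Periodic.setIntegral_Icc_comp_sum_int_mul {f : ℝ → ℝ}
    (hf : Function.Periodic f 1) (hc : Continuous f) {d : ℕ} {γ : Fin d → ℤ} (hγ : γ ≠ 0) :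
    ∫ x in Set.Icc (0 : Fin d → ℝ) 1, f (∑ i, (γ i : ℝ) * x i) = ∫ t in (0 : ℝ)..1, f t := by
  obtain ⟨i, hi⟩ := Function.ne_iff.1 hγ
  obtain _ | n := d
  · exact i.elim0
  have hint : IntegrableOn (fun x : Fin (n + 1) → ℝ => f (∑ i, (γ i : ℝ) * x i))
      (Set.Icc 0 1) volume :=
    Continuous.integrableOn_Icc (by fun_prop)
  have hμ : (volume : Measure (Fin (n + 1) → ℝ)).restrict (Set.Icc 0 1) =
      Measure.pi fun _ => volume.restrict (Set.Icc (0 : ℝ) 1) := by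
    rw [← Set.pi_univ_Icc, volume_pi, Measure.restrict_pi_pi]
    rfl
  have hmp := (measurePreserving_piFinSuccAbove
    (fun _ : Fin (n + 1) => volume.restrict (Set.Icc (0 : ℝ) 1)) i).symm
  rw [IntegrableOn, hμ] at hint
  rw [hμ, ← hmp.integral_comp (MeasurableEquiv.measurableEmbedding _)]
  rw [← hmp.integrable_comp_emb (MeasurableEquiv.measurableEmbedding _)] at hint
  have hprob : IsProbabilityMeasure (volume.restrict (Set.Icc (0 : ℝ) 1)) :=
    ⟨by simp⟩
  refine (integral_prod_symm _ hint).trans ?_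
  have hinner : ∀ y : Fin n → ℝ, ∫ s in Set.Icc (0 : ℝ) 1,
      f (∑ k, (γ k : ℝ) * i.insertNth (α := fun _ => ℝ) s y k) = ∫ t in (0 : ℝ)..1, f t := by
    intro y
    rw [integral_Icc_eq_integral_Ioc, ← intervalIntegral.integral_of_le zero_le_one,
      ← hf.intervalIntegral_comp_int_mul_add hc hi (∑ k, (γ (i.succAbove k) : ℝ) * y k)]
    refine intervalIntegral.integral_congr fun s _ => ?_
    simp [Fin.sum_univ_succAbove _ i]
  simp [hinner]

/-- If `(2q+1)·α = (2p+1)·β` with `gcd(2p+1, 2q+1) = 1`, then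
`3⟨𝒮(α·x), 𝒮(β·x)⟩ = (-1)^{p+q}/((2p+1)²(2q+1)²)` in `L²([0,1]^d)`. -/
theorem inner_SS_multivariate (d : ℕ) (hd : 1 ≤ d) (α β : Fin d → ℤ)
    (hα : PosLead α) (hβ : PosLead β) (p q : ℕ)
    (hpq : Nat.gcd (2 * p + 1) (2 * q + 1) = 1)
    (h : ∀ i, ((2 * q + 1 : ℕ) : ℤ) * α i = ((2 * p + 1 : ℕ) : ℤ) * β i) :
    3 * ∫ x in Set.Icc (0 : Fin d → ℝ) 1,
        Sfun (∑ i, (α i : ℝ) * x i) * Sfun (∑ i, (β i : ℝ) * x i)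
      = (-1 : ℝ) ^ (p + q) / ((2 * (p : ℝ) + 1) ^ 2 * (2 * (q : ℝ) + 1) ^ 2) := by
  obtain ⟨γ, hγα, hγβ⟩ : ∃ γ : Fin d → ℤ, (∀ i, α i = (2 * p + 1) * γ i) ∧
      ∀ i, β i = (2 * q + 1) * γ i := by
    have hdvd : ∀ i, ((2 * p + 1 : ℕ) : ℤ) ∣ α i := fun i =>
      (Nat.isCoprime_iff_coprime.2 hpq).dvd_of_dvd_mul_left ⟨β i, h i⟩
    choose γ hγ using hdvd
    refine ⟨γ, fun i => by simpa using hγ i, fun i => ?_⟩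
    have hi := h i
    rw [hγ i, mul_left_comm] at hi
    simpa using (mul_left_cancel₀ (by positivity) hi).symm
  have hγ : γ ≠ 0 := by
    rintro rfl
    obtain ⟨i, hi, -⟩ := hα
    simp [hγα i] at hi
  have hS := continuous_Sfun
  have hper : Function.Periodic
      (fun t : ℝ => Sfun ((2 * p + 1) * t) * Sfun ((2 * q + 1) * t)) 1 := by
    intro t
    have h1 := Sfun_add_int ((2 * p + 1) * t) (2 * p + 1)
    have h2 := Sfun_add_int ((2 * q + 1) * t) (2 * q + 1)
    push_cast at h1 h2
    simp only [mul_add_one, h1, h2]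
  have key := hper.setIntegral_Icc_comp_sum_int_mul (by fun_prop) hγ
  rw [integral_Sfun_odd_mul_Sfun_odd p q hpq] at key
  simp only [hγα, hγβ, Int.cast_mul, Int.cast_add, Int.cast_ofNat, Int.cast_natCast, Int.cast_one,
    mul_assoc, ← Finset.mul_sum] at key ⊢
  rw [key]
  ring
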